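/- arXiv:2312.04955 — 3 statements merged into one kernel-verified Lean document; each statement's English description precedes it below -/
import Mathlib

section
/- Let χ, m ≥ 2 be integers and write R = R⃗(χ). Then there exists an integer M_0 = M_0(χ, m) such that the following holds for any M ≥ M_0. Let K = K_{RM}^{(3)} be red/blue-edge-coloured and suppose its vertex set is partitioned into R sets V_1, …, V_R, each inducing a red copy of K_M^{(3)}. Then at least one of the following holds: (a) for every choice of subsets W_i ⊆ V_i satisfying |W_i| ≥ M/2 for all i ∈ [R], there exists a red tight path of length two in the subgraph induced on the union of the W_i connecting W_j and W_{j'} for some distinct j, j' ∈ [R]; (b) K contains a blue copy of H(TT_χ, m). -/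
open scoped Classical

/-- There is a copy of the hypergraph with edge set `F` all of whose edges receive
colour `b` under the red/blue colouring `c` (`true` = red, `false` = blue) of the
complete hypergraph on the vertex type `V`. -/
def hasMonoCopy {V W : Type*} [DecidableEq V] [DecidableEq W]
    (c : Finset V → Bool) (b : Bool) (F : Finset (Finset W)) : Prop :=
  ∃ f : W → V, Function.Injective f ∧ ∀ e ∈ F, c (e.image f) = b

/-- The Ramsey number of a pair of hypergraphs: the least `N` such that every
red/blue colouring of the complete hypergraph on `N` vertices contains a red copy
of `G` or a blue copy of `H`. -/
noncomputable def ramseyNumber {V W : Type*} [DecidableEq V] [DecidableEq W]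
    (G : Finset (Finset V)) (H : Finset (Finset W)) : ℕ :=
  sInf {N : ℕ | ∀ c : Finset (Fin N) → Bool,
    hasMonoCopy c true G ∨ hasMonoCopy c false H}

/-- `E` is a `k`-uniform hypergraph: every edge has exactly `k` vertices. -/
def IsUniformHyp {V : Type*} (k : ℕ) (E : Finset (Finset V)) : Prop :=
  ∀ e ∈ E, e.card = k
/-- A tournament: an orientation of the complete graph. -/
def IsTournament {V : Type*} (T : V → V → Prop) : Prop :=
  (∀ v, ¬ T v v) ∧ ∀ u v : V, u ≠ v → (T u v ↔ ¬ T v u)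

/-- The tournament `T` contains a copy of the transitive tournament on `ℓ` vertices. -/
def ContainsTransTourn {V : Type*} (T : V → V → Prop) (ℓ : ℕ) : Prop :=
  ∃ f : Fin ℓ → V, Function.Injective f ∧ ∀ i j : Fin ℓ, i < j → T (f i) (f j)

/-- `R⃗(ℓ)`: the least `N` such that every tournament on at least `N` vertices
contains a transitive tournament on `ℓ` vertices. -/
noncomputable def dirRamsey (ℓ : ℕ) : ℕ :=
  sInf {N : ℕ | ∀ M : ℕ, N ≤ M → ∀ T : Fin M → Fin M → Prop,
    IsTournament T → ContainsTransTourn T ℓ}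
/-- The tournament hypergraph `H(TT_χ, m)` associated to the transitive tournament
on `[χ]` (with arcs `i → j` for `i < j`), with vertex classes `{i} × Fin m`:
its edges are the triples with two vertices in class `i` and one in class `j`,
where `i < j`. -/
def transTournHyp (χ m : ℕ) : Finset (Finset (Fin χ × Fin m)) :=
  Finset.univ.filter (fun e : Finset (Fin χ × Fin m) =>
    ∃ x ∈ e, ∃ y ∈ e, ∃ z ∈ e, x ≠ y ∧ e = {x, y, z} ∧ x.1 = y.1 ∧ x.1 < z.1)

theorem aux_trans {V : Type} [DecidableEq V] (T : V → V → Prop)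
    (hT : ∀ u v, u ≠ v → T u v ∨ T v u) :
    ∀ (l : ℕ) (S : Finset V), 2 ^ l ≤ S.card →
      ∃ L : List V, L.length = l ∧ (∀ x ∈ L, x ∈ S) ∧
        L.Pairwise (fun u v => T u v ∧ u ≠ v) := by
  intro l
  induction l with
  | zero => intro S _; exact ⟨[], by simp⟩
  | succ l ih =>
    intro S hS
    have hp : 0 < 2 ^ (l + 1) := by positivity
    obtain ⟨v, hv⟩ := Finset.card_pos.mp (lt_of_lt_of_le hp hS)
    have h1 := Finset.card_filter_add_card_filter_not (s := S.erase v) (fun u => T v u)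
    have h2 := Finset.card_erase_of_mem hv
    by_cases h : 2 ^ l ≤ ((S.erase v).filter (fun u => T v u)).card
    · obtain ⟨L, hl, hs, hpw⟩ := ih _ h
      refine ⟨v :: L, by simp [hl], ?_, ?_⟩
      · intro x hx
        rcases List.mem_cons.mp hx with rfl | hx
        · exact hv
        · have := hs x hx
          simp at this; exact this.1.2
      · refine List.pairwise_cons.mpr ⟨?_, hpw⟩
        intro x hx
        have := hs x hx
        simp at this
        exact ⟨this.2, fun e => this.1.1 e.symm⟩
    · have h' : 2 ^ l ≤ ((S.erase v).filter (fun u => ¬ T v u)).card := by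
        rw [pow_succ] at hS; omega
      obtain ⟨L, hl, hs, hpw⟩ := ih _ h'
      refine ⟨L ++ [v], by simp [hl], ?_, ?_⟩
      · intro x hx
        rcases List.mem_append.mp hx with hx | hx
        · have := hs x hx
          simp at this; exact this.1.2
        · simp at hx; exact hx ▸ hv
      · refine List.pairwise_append.mpr ⟨hpw, by simp, ?_⟩
        intro x hx y hy
        have := hs x hx
        simp at this
        simp at hy
        subst hy
        exact ⟨(hT x y this.1.1).resolve_right this.2, this.1.1⟩

theorem aux_dirRamsey (l M : ℕ) (hM : dirRamsey l ≤ M) (T : Fin M → Fin M → Prop)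
    (hT : IsTournament T) : ContainsTransTourn T l := by
  have hne : {N : ℕ | ∀ M : ℕ, N ≤ M → ∀ T : Fin M → Fin M → Prop,
    IsTournament T → ContainsTransTourn T l}.Nonempty := by
    refine ⟨2 ^ l, ?_⟩
    intro M hM T hT
    obtain ⟨L, hl, -, hpw⟩ := aux_trans T (fun u v h => by
      by_cases h' : T v u
      · exact Or.inr h'
      · exact Or.inl ((hT.2 u v h).mpr h')) l Finset.univ (by simpa using hM)
    subst hl
    have hlt : ∀ i j : Fin L.length, i < j → T (L.get i) (L.get j) ∧ L.get i ≠ L.get j :=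
      List.pairwise_iff_get.mp hpw
    refine ⟨L.get, ?_, fun i j h => (hlt i j h).1⟩
    intro i j h
    rcases lt_trichotomy i j with h' | h' | h'
    · exact absurd h (hlt i j h').2
    · exact h'
    · exact absurd h.symm (hlt j i h').2
  exact Nat.sInf_mem hne M hM T hT

theorem aux_kst (a : ℕ) : ∃ N : ℕ, a ≤ N ∧ ∀ (V : Type) (r : V → V → Prop) (A B : Finset V),
    N ≤ A.card → N ≤ B.card → ∃ A' ⊆ A, ∃ B' ⊆ B, A'.card = a ∧ B'.card = a ∧
      ((∀ x ∈ A', ∀ y ∈ B', r x y) ∨ (∀ x ∈ A', ∀ y ∈ B', ¬ r x y)) := by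
  refine ⟨2 ^ (2 * a) * a + 2 * a, by omega, ?_⟩
  intro V r A B hA hB
  obtain ⟨A₀, hA₀, hc⟩ := Finset.exists_subset_card_eq (show 2 * a ≤ A.card by omega)
  have hmaps : ∀ b ∈ B, A₀.filter (fun x => r x b) ∈ A₀.powerset := by
    intro b _; simp
  obtain ⟨Q, hQ, hQc⟩ := Finset.exists_le_card_fiber_of_mul_le_card_of_maps_to
    (n := a) hmaps ⟨∅, by simp⟩ (by rw [Finset.card_powerset, hc]; omega)
  obtain ⟨B', hB', hBc⟩ := Finset.exists_subset_card_eq hQc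
  have hB2 : ∀ y ∈ B', y ∈ B ∧ A₀.filter (fun x => r x y) = Q := by
    intro y hy
    simpa using hB' hy
  have hQ' : Q ⊆ A₀ := Finset.mem_powerset.mp hQ
  have hsd := Finset.card_sdiff_add_card_eq_card hQ'
  by_cases h : a ≤ Q.card
  · obtain ⟨A', hA', hAc⟩ := Finset.exists_subset_card_eq h
    refine ⟨A', (hA'.trans hQ').trans hA₀, B', fun y hy => (hB2 y hy).1, hAc, hBc, Or.inl ?_⟩
    intro x hx y hy
    have := hA' hx
    rw [← (hB2 y hy).2] at this
    exact (Finset.mem_filter.mp this).2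
  · obtain ⟨A', hA', hAc⟩ := Finset.exists_subset_card_eq (show a ≤ (A₀ \ Q).card by omega)
    refine ⟨A', (hA'.trans Finset.sdiff_subset).trans hA₀, B', fun y hy => (hB2 y hy).1,
      hAc, hBc, Or.inr ?_⟩
    intro x hx y hy hr
    have := Finset.mem_sdiff.mp (hA' hx)
    rw [← (hB2 y hy).2] at this
    exact this.2 (Finset.mem_filter.mpr ⟨this.1, hr⟩)

theorem aux_multi {ι : Type} (m : ℕ) (P : List (ι × ι)) (hP : ∀ p ∈ P, p.1 ≠ p.2) :
    ∃ N : ℕ, ∀ (V : Type) (r : ι → ι → V → V → Prop) (W : ι → Finset V),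
      (∀ i, N ≤ (W i).card) → ∃ U : ι → Finset V, (∀ i, U i ⊆ W i ∧ (U i).card = m) ∧
        ∀ p ∈ P, (∀ x ∈ U p.1, ∀ y ∈ U p.2, r p.1 p.2 x y) ∨
          (∀ x ∈ U p.1, ∀ y ∈ U p.2, ¬ r p.1 p.2 x y) := by
  induction P generalizing m with
  | nil =>
    refine ⟨m, fun V r W hW => ?_⟩
    choose U hU using fun i => Finset.exists_subset_card_eq (hW i)
    exact ⟨U, hU, by simp⟩
  | cons p P ih =>
    obtain ⟨K, hK, hk⟩ := aux_kst m
    obtain ⟨N, hN⟩ := ih K (fun q hq => hP q (List.mem_cons_of_mem _ hq))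
    have hne := hP p List.mem_cons_self
    refine ⟨N, fun V r W hW => ?_⟩
    obtain ⟨U, hU, hUP⟩ := hN V r W hW
    obtain ⟨A, hA, B, hB, hAc, hBc, hr⟩ := hk V (r p.1 p.2) (U p.1) (U p.2)
      (hU p.1).2.ge (hU p.2).2.ge
    choose U' hU' using fun i => Finset.exists_subset_card_eq (hK.trans (hU i).2.ge)
    let X : ι → Finset V := fun i => if i = p.1 then A else if i = p.2 then B else U' i
    have hX1 : X p.1 = A := by simp [X]
    have hX2 : X p.2 = B := by simp [X, hne.symm]
    have hX : ∀ i, X i ⊆ U i ∧ (X i).card = m := by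
      intro i
      by_cases h1 : i = p.1
      · rw [h1, hX1]; exact ⟨hA, hAc⟩
      · by_cases h2 : i = p.2
        · rw [h2, hX2]; exact ⟨hB, hBc⟩
        · have : X i = U' i := by simp [X, h1, h2]
          rw [this]; exact hU' i
    refine ⟨X, fun i => ⟨(hX i).1.trans (hU i).1, (hX i).2⟩, ?_⟩
    intro q hq
    rcases List.mem_cons.mp hq with rfl | hq
    · rw [hX1, hX2]; exact hr
    · rcases hUP q hq with h | h
      · exact Or.inl fun x hx y hy => h x ((hX _).1 hx) y ((hX _).1 hy)
      · exact Or.inr fun x hx y hy => h x ((hX _).1 hx) y ((hX _).1 hy)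

/-- Lemma (butterflies): for every red/blue colouring of `K_{RM}^{(3)}` (`R = R⃗(χ)`)
whose vertex set is partitioned into `R` classes of size `M`, each inducing a red
clique, either every choice of subsets `W_i` of the classes with `|W_i| ≥ M/2` is
connected by a red tight path of length two between two distinct `W_j, W_{j'}`,
or there is a blue copy of `H(TT_χ, m)`. -/
theorem butterflies (χ m : ℕ) (hχ : 2 ≤ χ) (hm : 2 ≤ m) :
    ∃ M₀ : ℕ, ∀ M : ℕ, M₀ ≤ M →
      ∀ (c : Finset (Fin (dirRamsey χ * M)) → Bool)
        (part : Fin (dirRamsey χ * M) → Fin (dirRamsey χ)),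
        (∀ i, (Finset.univ.filter (fun v => part v = i)).card = M) →
        (∀ (i) (e : Finset (Fin (dirRamsey χ * M))), e.card = 3 →
          (∀ v ∈ e, part v = i) → c e = true) →
        ((∀ W : Fin (dirRamsey χ) → Finset (Fin (dirRamsey χ * M)),
            (∀ i, W i ⊆ Finset.univ.filter (fun v => part v = i) ∧
              (M : ℝ) / 2 ≤ ((W i).card : ℝ)) →
            ∃ j j', j ≠ j' ∧ ∃ v₁ v₂ v₃ v₄,
              v₁ ≠ v₂ ∧ v₁ ≠ v₃ ∧ v₁ ≠ v₄ ∧ v₂ ≠ v₃ ∧ v₂ ≠ v₄ ∧ v₃ ≠ v₄ ∧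
              c {v₁, v₂, v₃} = true ∧ c {v₂, v₃, v₄} = true ∧
              v₁ ∈ W j ∧ v₂ ∈ W j ∧ v₃ ∈ W j' ∧ v₄ ∈ W j') ∨
          hasMonoCopy c false (transTournHyp χ m)) := by
  obtain ⟨N, hN⟩ := aux_multi (ι := Fin (dirRamsey χ)) m
    ((Finset.univ.filter (fun p : Fin (dirRamsey χ) × Fin (dirRamsey χ) => p.1 ≠ p.2)).toList)
    (by intro p hp; simpa using hp)
  refine ⟨2 * N, ?_⟩
  intro M hM c part _ _
  refine or_iff_not_imp_left.mpr ?_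
  intro hna
  push Not at hna
  obtain ⟨W, hW, hno⟩ := hna
  have hWc : ∀ i, N ≤ (W i).card := by
    intro i
    have h1 := (hW i).2
    have h2 : (2 * N : ℝ) ≤ M := by exact_mod_cast hM
    have : (N : ℝ) ≤ (W i).card := by linarith
    exact_mod_cast this
  have hWp : ∀ i, ∀ v ∈ W i, part v = i := by
    intro i v hv
    simpa using (hW i).1 hv
  obtain ⟨U, hU, hUP⟩ := hN _ (fun i _ u v => ∀ x ∈ W i, x ≠ u → c {x, u, v} = false) W hWc
  let D : Fin (dirRamsey χ) → Fin (dirRamsey χ) → Prop := fun i j =>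
    ∀ x ∈ U i, ∀ y ∈ U i, ∀ z ∈ U j, x ≠ y → c {x, y, z} = false
  have hD : ∀ i j, i ≠ j → D i j ∨ D j i := by
    intro i j hij
    rcases hUP (i, j) (by simpa using hij) with h | h
    · left
      intro x hx y hy z hz hxy
      exact h y hy z hz x ((hU i).1 hx) hxy
    · right
      intro x hx y hy z hz hxy
      have h3 := h z hz x hx
      push Not at h3
      obtain ⟨w, hw, hwz, hc⟩ := h3
      have hz' := (hU i).1 hz
      have hx' := (hU j).1 hx
      have hy' := (hU j).1 hy
      have hd : ∀ a ∈ W i, ∀ b ∈ W j, a ≠ b := by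
        intro a ha b hb e
        apply hij
        rw [← hWp i a ha, ← hWp j b hb, e]
      by_contra hcc
      have hs : ({x, y, z} : Finset (Fin (dirRamsey χ * M))) = {z, x, y} := by
        ext t; simp; tauto
      rw [hs] at hcc
      exact hno i j hij w z x y hwz (hd w hw x hx') (hd w hw y hy') (hd z hz' x hx')
        (hd z hz' y hy') hxy (by simpa using hc) (by simpa using hcc) hw hz' hx' hy'
  let T : Fin (dirRamsey χ) → Fin (dirRamsey χ) → Prop := fun i j =>
    (i < j ∧ D i j) ∨ (j < i ∧ ¬ D j i)
  have hT : IsTournament T := by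
    refine ⟨fun v => by simp [T], fun u v huv => ?_⟩
    rcases lt_or_gt_of_ne huv with h | h
    · simp [T, h, h.not_gt]
    · simp [T, h, h.not_gt]
  have hTD : ∀ i j, T i j → D i j := by
    rintro i j (⟨_, h⟩ | ⟨h', h⟩)
    · exact h
    · exact (hD i j h'.ne').resolve_right h
  obtain ⟨g, hg, hgT⟩ := aux_dirRamsey χ _ le_rfl T hT
  let F : Fin χ × Fin m → Fin (dirRamsey χ * M) := fun p =>
    ((U (g p.1)).equivFinOfCardEq (hU _).2).symm p.2
  have hF : ∀ p, F p ∈ U (g p.1) := fun p =>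
    (((U (g p.1)).equivFinOfCardEq (hU _).2).symm p.2).2
  have hinj : Function.Injective F := by
    rintro ⟨a, k⟩ ⟨b, l⟩ h
    have h1 := hWp _ _ ((hU _).1 (hF (a, k)))
    have h2 := hWp _ _ ((hU _).1 (hF (b, l)))
    rw [h, h2] at h1
    have hab : b = a := hg h1
    subst hab
    have h3 := Subtype.ext h
    simp at h3
    rw [h3]
  refine ⟨F, hinj, ?_⟩
  intro e he
  obtain ⟨x, -, y, -, z, -, hxy, rfl, h1, h2⟩ := (Finset.mem_filter.mp he).2
  have himg : Finset.image F {x, y, z} = {F x, F y, F z} := by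
    simp [Finset.image_insert]
  have hy := hF y
  rw [← h1] at hy
  have key := hTD _ _ (hgT _ _ h2) (F x) (hF x) (F y) hy (F z) (hF z) (fun h => hxy (hinj h))
  rw [← himg] at key
  convert key
end

section
/- Let χ, m ≥ 2 be integers. Then there exists a real constant γ = γ(χ, m) > 0 such that the following holds. Let F be a subhypergraph of a tournament hypergraph associated to TT_χ with vertex classes V_1, …, V_χ. If |V_i| ≥ 1/γ for each i ∈ [χ] and d(V_i, V_i, V_j) ≥ 1 - γ for every arc (i,j) of TT_χ, then F contains a copy of H(TT_χ, m). -/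
open scoped Classical

/-- `d(A,B,C)`: the proportion of ordered triples `(a,b,c) ∈ A × B × C` of pairwise
distinct vertices forming an edge of `E`. -/
noncomputable def tripleDensity {V : Type*} [DecidableEq V]
    (E : Finset (Finset V)) (A B C : Finset V) : ℝ :=
  (((A ×ˢ B ×ˢ C).filter (fun z =>
      z.1 ≠ z.2.1 ∧ z.1 ≠ z.2.2 ∧ z.2.1 ≠ z.2.2 ∧
        ({z.1, z.2.1, z.2.2} : Finset V) ∈ E)).card : ℝ) /
  (((A ×ˢ B ×ˢ C).filter (fun z =>
      z.1 ≠ z.2.1 ∧ z.1 ≠ z.2.2 ∧ z.2.1 ≠ z.2.2)).card : ℝ)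


lemma re_count {ι V : Type} [Fintype ι] [DecidableEq ι] [DecidableEq V] (s : ι → Finset V) (x y z : ι)
    (hxy : x ≠ y) (hxz : x ≠ z) (hyz : y ≠ z) (G : Finset (V × V × V))
    (hG : G ⊆ s x ×ˢ s y ×ˢ s z) (δ : ℝ)
    (h : ((s x ×ˢ s y ×ˢ s z).card : ℝ) - G.card ≤ δ * (s x ×ˢ s y ×ˢ s z).card)
    (hpos : (0 : ℝ) < (s x ×ˢ s y ×ˢ s z).card) :
    (((Fintype.piFinset s).filter (fun g => (g x, g y, g z) ∉ G)).card : ℝ)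
      ≤ δ * (Fintype.piFinset s).card := by
  set P := s x ×ˢ s y ×ˢ s z with hP
  set C : ℕ := ∏ p, (if p = x ∨ p = y ∨ p = z then 1 else (s p).card) with hC
  have fib : ∀ t ∈ P, ((Fintype.piFinset s).filter (fun g => (g x, g y, g z) = t)).card = C := by
    rintro ⟨a, b, c⟩ ht
    simp only [hP, Finset.mem_product] at ht
    have : (Fintype.piFinset s).filter (fun g => (g x, g y, g z) = (a, b, c)) =
        Fintype.piFinset (fun p => if p = x then {a} else if p = y then {b} else
          if p = z then {c} else s p) := by
      ext g
      simp only [Finset.mem_filter, Fintype.mem_piFinset, Prod.mk.injEq]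
      constructor
      · rintro ⟨h1, h2, h3, h4⟩ p
        split_ifs with e1 e2 e3
        · simp [e1, h2]
        · simp [e2, h3]
        · simp [e3, h4]
        · exact h1 p
      · intro h1
        have ex : g x = a := by simpa using h1 x
        have ey : g y = b := by simpa [hxy.symm] using h1 y
        have ez : g z = c := by simpa [hxz.symm, hyz.symm] using h1 z
        refine ⟨fun p => ?_, ex, ey, ez⟩
        by_cases e1 : p = x
        · subst e1; rw [ex]; exact ht.1
        by_cases e2 : p = y
        · subst e2; rw [ey]; exact ht.2.1
        by_cases e3 : p = z
        · subst e3; rw [ez]; exact ht.2.2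
        simpa [e1, e2, e3] using h1 p
    rw [this, Fintype.card_piFinset, hC]
    refine Finset.prod_congr rfl fun p _ => ?_
    by_cases e1 : p = x
    · simp [e1]
    by_cases e2 : p = y
    · simp [e2, hxy.symm]
    by_cases e3 : p = z
    · simp [e3, hxz.symm, hyz.symm]
    simp [e1, e2, e3]
  have tot : (Fintype.piFinset s).card = P.card * C := by
    rw [Finset.card_eq_sum_card_fiberwise (f := fun g => (g x, g y, g z)) (t := P),
      Finset.sum_congr rfl fib]
    · simp
    · intro g hg
      have := Fintype.mem_piFinset.1 (Finset.mem_coe.1 hg)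
      simp [hP, this]
  have bad : ((Fintype.piFinset s).filter (fun g => (g x, g y, g z) ∉ G)).card
      = (P \ G).card * C := by
    rw [Finset.card_eq_sum_card_fiberwise (f := fun g => (g x, g y, g z)) (t := P \ G)]
    · rw [← smul_eq_mul, ← Finset.sum_const]
      refine Finset.sum_congr rfl fun t ht => ?_
      rw [Finset.mem_sdiff] at ht
      rw [← fib t ht.1, Finset.filter_filter]
      congr 1
      refine Finset.filter_congr fun g _ => ?_
      constructor
      · exact fun h => h.2
      · exact fun h => ⟨by rw [h]; exact ht.2, h⟩
    · intro g hg
      have hg' := Finset.mem_filter.1 (Finset.mem_coe.1 hg)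
      have := Fintype.mem_piFinset.1 hg'.1
      rw [Finset.mem_coe, Finset.mem_sdiff]
      exact ⟨by simp [hP, this], hg'.2⟩
  have hc : ((P \ G).card : ℝ) = P.card - G.card := by
    have := Finset.card_sdiff_add_card_eq_card hG
    rw [← this]; push_cast; ring
  rw [bad, tot]
  push_cast
  rw [hc, ← mul_assoc]
  exact mul_le_mul_of_nonneg_right h (Nat.cast_nonneg _)

lemma re_D {V : Type} [DecidableEq V] (A C : Finset V) :
    ((A ×ˢ A ×ˢ C).card : ℝ) - A.card * C.card ≤
      ((A ×ˢ A ×ˢ C).filter (fun t => t.1 ≠ t.2.1)).card := by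
  have h1 := Finset.card_filter_add_card_filter_not (s := A ×ˢ A ×ˢ C) (fun t => t.1 = t.2.1)
  have h2 : ((A ×ˢ A ×ˢ C).filter (fun t => t.1 = t.2.1)).card ≤ (A ×ˢ C).card := by
    apply Finset.card_le_card_of_injOn (fun t => t.2)
    · rintro ⟨a, b, c⟩ ht
      simp at ht ⊢
      tauto
    · rintro ⟨a, b, c⟩ ht ⟨a', b', c'⟩ ht' h
      simp at ht ht' h ⊢
      grind
  rw [Finset.card_product A C] at h2
  have h3 : ((A ×ˢ A ×ˢ C).filter (fun t => t.1 = t.2.1)).card +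
    ((A ×ˢ A ×ˢ C).filter (fun t => t.1 ≠ t.2.1)).card = (A ×ˢ A ×ˢ C).card := h1
  have h2' : (((A ×ˢ A ×ˢ C).filter (fun t => t.1 = t.2.1)).card : ℝ) ≤ A.card * C.card := by
    exact_mod_cast h2
  rw [← h3]; push_cast; linarith

/-- Random embedding lemma: there is `γ = γ(χ,m) > 0` such that any subhypergraph `F`
of a tournament hypergraph associated to `TT_χ` with vertex classes of size at least
`1/γ` and `d(V_i, V_i, V_j) ≥ 1 - γ` for every arc `(i,j)` of `TT_χ` contains a copy
of `H(TT_χ, m)`. -/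
theorem random_embedding (χ m : ℕ) (hχ : 2 ≤ χ) (hm : 2 ≤ m) :
    ∃ γ : ℝ, 0 < γ ∧
      ∀ (N : ℕ) (E : Finset (Finset (Fin N))) (part : Fin N → Fin χ),
        (∀ e ∈ E, ∃ x ∈ e, ∃ y ∈ e, ∃ z ∈ e, x ≠ y ∧ e = {x, y, z} ∧
          part x = part y ∧ part x < part z) →
        (∀ i : Fin χ,
          1 / γ ≤ ((Finset.univ.filter (fun v => part v = i)).card : ℝ)) →
        (∀ i j : Fin χ, i < j →
          1 - γ ≤ tripleDensity E (Finset.univ.filter (fun v => part v = i))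
            (Finset.univ.filter (fun v => part v = i))
            (Finset.univ.filter (fun v => part v = j))) →
        ∃ f : Fin χ × Fin m → Fin N, Function.Injective f ∧
          ∀ e ∈ transTournHyp χ m, e.image f ∈ E := by
  set M : ℕ := Fintype.card ((Fin χ × Fin m) × (Fin χ × Fin m) × (Fin χ × Fin m)) with hM
  have hγ : (0 : ℝ) < 1 / (2 * M + 2) := by positivity
  refine ⟨1 / (2 * M + 2), hγ, ?_⟩
  intro N E part _ hcard hdens
  have hγ1 : (1 / (2 * M + 2) : ℝ) < 1 := by
    rw [div_lt_one (by positivity)]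
    have : (0 : ℝ) ≤ M := Nat.cast_nonneg _
    linarith
  have hMγ : (M : ℝ) * (2 * (1 / (2 * M + 2))) < 1 := by
    have : (0 : ℝ) ≤ M := Nat.cast_nonneg _
    rw [← mul_assoc, mul_one_div, div_lt_one (by positivity)]
    linarith
  generalize (1 / (2 * M + 2) : ℝ) = γ at *
  set A : Fin χ → Finset (Fin N) := fun i => Finset.univ.filter (fun v => part v = i) with hA
  have hn : ∀ i, 1 ≤ γ * (A i).card := fun i => by
    have := hcard i
    rw [div_le_iff₀ hγ] at this
    linarith
  have hn0 : ∀ i, (0 : ℝ) < (A i).card := fun i => by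
    by_contra h
    have := hn i
    nlinarith
  have hmem : ∀ i v, v ∈ A i ↔ part v = i := fun i v => by simp [hA]
  set D : Fin χ → Fin χ → Finset (Fin N × Fin N × Fin N) := fun i j =>
    (A i ×ˢ A i ×ˢ A j).filter (fun t => t.1 ≠ t.2.1) with hD
  set G : Fin χ → Fin χ → Finset (Fin N × Fin N × Fin N) := fun i j =>
    (D i j).filter (fun t => i < j → ({t.1, t.2.1, t.2.2} : Finset (Fin N)) ∈ E) with hG
  have hPc : ∀ i j, ((A i ×ˢ A i ×ˢ A j).card : ℝ) = (A i).card * (A i).card * (A j).card := by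
    intro i j
    simp only [Finset.card_product]; push_cast; ring
  have hDle : ∀ i j, ((D i j).card : ℝ) ≤ (A i ×ˢ A i ×ˢ A j).card := fun i j => by
    exact_mod_cast Finset.card_le_card (Finset.filter_subset _ _)
  have hGD : ∀ i j, i ≠ j → (1 - γ) * (D i j).card ≤ (G i j).card := by
    intro i j hij
    by_cases hlt : i < j
    · have h := hdens i j hlt
      have e1 : D i j = (A i ×ˢ A i ×ˢ A j).filter (fun z =>
          z.1 ≠ z.2.1 ∧ z.1 ≠ z.2.2 ∧ z.2.1 ≠ z.2.2) := by
        ext ⟨a, b, c⟩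
        simp only [hD, Finset.mem_filter, Finset.mem_product, hmem]
        grind
      have e2 : G i j = (A i ×ˢ A i ×ˢ A j).filter (fun z =>
          z.1 ≠ z.2.1 ∧ z.1 ≠ z.2.2 ∧ z.2.1 ≠ z.2.2 ∧
            ({z.1, z.2.1, z.2.2} : Finset (Fin N)) ∈ E) := by
        ext ⟨a, b, c⟩
        simp only [hG, e1, Finset.mem_filter]
        grind
      have h' : 1 - γ ≤ ((G i j).card : ℝ) / (D i j).card := by
        rw [e1, e2]
        unfold tripleDensity at h
        convert h using 1
      rcases eq_or_lt_of_le (Nat.cast_nonneg (α := ℝ) (D i j).card) with h0 | h0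
      · rw [← h0]; simp
      · rwa [le_div_iff₀ h0] at h'
    · have : G i j = D i j := by
        simp [hG, hlt]
      rw [this]
      have : (0 : ℝ) ≤ (D i j).card := Nat.cast_nonneg _
      nlinarith
  set s : Fin χ × Fin m → Finset (Fin N) := fun p => A p.1 with hs
  have key : ∀ x y z : Fin χ × Fin m, x ≠ y → x.1 = y.1 → x.1 ≠ z.1 →
      (((Fintype.piFinset s).filter (fun g => (g x, g y, g z) ∉ G x.1 z.1)).card : ℝ)
      ≤ (2 * γ) * (Fintype.piFinset s).card := by
    intro x y z hxy h1 h2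
    have hP : s x ×ˢ s y ×ˢ s z = A x.1 ×ˢ A x.1 ×ˢ A z.1 := by simp only [hs, h1]
    apply re_count s x y z hxy (fun h => h2 (by rw [h])) (fun h => h2 (by rw [h1, h]))
    · rw [hP]
      exact (Finset.filter_subset _ _).trans (Finset.filter_subset _ _)
    · rw [hP]
      have a1 := hGD x.1 z.1 h2
      have a2 := re_D (A x.1) (A z.1)
      have a3 := hDle x.1 z.1
      have a4 := hn x.1
      have a5 := mul_pos (hn0 x.1) (hn0 z.1)
      have a6 := mul_le_mul_of_nonneg_left a3 hγ.le
      have a7 := mul_le_mul_of_nonneg_right a4 a5.le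
      change _ ≤ ((D x.1 z.1).card : ℝ) at a2
      rw [hPc] at *
      linarith
    · rw [hP, hPc]
      exact mul_pos (mul_pos (hn0 _) (hn0 _)) (hn0 _)
  have hΩ : (0 : ℝ) < (Fintype.piFinset s).card := by
    rw [Fintype.card_piFinset]
    push_cast
    exact Finset.prod_pos fun p _ => hn0 p.1
  have ex : ∃ g ∈ Fintype.piFinset s, ∀ x y z : Fin χ × Fin m, x ≠ y → x.1 = y.1 →
      x.1 ≠ z.1 → (g x, g y, g z) ∈ G x.1 z.1 := by
    by_contra hcon
    push Not at hcon
    set B : (Fin χ × Fin m) × (Fin χ × Fin m) × (Fin χ × Fin m) →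
        Finset (Fin χ × Fin m → Fin N) := fun t =>
      if t.1 ≠ t.2.1 ∧ t.1.1 = t.2.1.1 ∧ t.1.1 ≠ t.2.2.1 then
        (Fintype.piFinset s).filter (fun g => (g t.1, g t.2.1, g t.2.2) ∉ G t.1.1 t.2.2.1)
      else ∅ with hB
    have hsub : Fintype.piFinset s ⊆ Finset.univ.biUnion B := by
      intro g hg
      obtain ⟨x, y, z, h1, h2, h3, h4⟩ := hcon g hg
      refine Finset.mem_biUnion.2 ⟨(x, y, z), Finset.mem_univ _, ?_⟩
      simp only [hB]
      rw [if_pos ⟨h1, h2, h3⟩]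
      exact Finset.mem_filter.2 ⟨hg, h4⟩
    have c1 : ((Fintype.piFinset s).card : ℝ) ≤ ∑ t, ((B t).card : ℝ) := by
      exact_mod_cast (Finset.card_le_card hsub).trans Finset.card_biUnion_le
    have c2 : ∑ t, ((B t).card : ℝ) ≤ ∑ t : (Fin χ × Fin m) × (Fin χ × Fin m) × (Fin χ × Fin m),
        (2 * γ) * ((Fintype.piFinset s).card : ℝ) := by
      refine Finset.sum_le_sum fun t _ => ?_
      by_cases ht : t.1 ≠ t.2.1 ∧ t.1.1 = t.2.1.1 ∧ t.1.1 ≠ t.2.2.1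
      · simp only [hB]
        rw [if_pos ht]
        exact key _ _ _ ht.1 ht.2.1 ht.2.2
      · simp only [hB]
        rw [if_neg ht]
        simp only [Finset.card_empty, Nat.cast_zero]
        positivity
    rw [Finset.sum_const, Finset.card_univ, ← hM, nsmul_eq_mul, ← mul_assoc] at c2
    have c3 := mul_lt_mul_of_pos_right hMγ hΩ
    linarith
  obtain ⟨g, hg, hgood⟩ := ex
  have hgp : ∀ p, part (g p) = p.1 := fun p => (hmem _ _).1 (Fintype.mem_piFinset.1 hg p)
  refine ⟨g, ?_, ?_⟩
  · intro p q hpq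
    by_contra hne
    have h1 : p.1 = q.1 := by rw [← hgp p, ← hgp q, hpq]
    haveI : Nontrivial (Fin χ) := Fin.nontrivial_iff_two_le.2 hχ
    obtain ⟨j, hj⟩ := exists_ne p.1
    have := hgood p q (j, p.2) hne h1 hj.symm
    exact (Finset.mem_filter.1 (Finset.mem_filter.1 this).1).2 hpq
  · intro e he
    obtain ⟨x, _, y, _, z, _, hxy, rfl, h1, h2⟩ := (Finset.mem_filter.1 he).2
    have := (Finset.mem_filter.1 (hgood x y z hxy h1 h2.ne)).2 h2
    simpa [Finset.image_insert] using this
end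

section
/- Let 0 < η ≤ 1 be a real number and d ≥ 1 be an integer. Let F be a 3-graph and A, B ⊆ V(F) be disjoint sets with |A| ≥ 4d·e^d/η^d and |B| ≥ d/η. Assume that A induces a clique in F (every 3-subset of A is an edge) and that d(A,A,B) ≥ η. Then F contains a 3-uniform tight path on the 3d+2 vertices a_1, a_2, b_1, a_3, a_4, b_2, …, a_{2d-1}, a_{2d}, b_d, a_{2d+1}, a_{2d+2} (in this order), where a_1, …, a_{2d+2} are distinct vertices of A and b_1, …, b_d are distinct vertices of B. -/
open scoped Classical

lemma ab_mindeg {V : Type*} [DecidableEq V] (A : Finset V) (G : V → V → Prop) (hs : ∀ x y, G x y → G y x)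
    (hi : ∀ x, ¬ G x x) (d : ℕ) (hd : 1 ≤ d) (hne : A.Nonempty)
    (h : 4 * d * A.card ≤ ∑ x ∈ A, (A.filter (G x)).card) :
    ∃ W ⊆ A, W.Nonempty ∧ ∀ x ∈ W, 2 * d + 1 ≤ (W.filter (G x)).card := by
  induction hn : A.card using Nat.strong_induction_on generalizing A with
  | _ n ih =>
  by_cases hall : ∀ x ∈ A, 2 * d + 1 ≤ (A.filter (G x)).card
  · exact ⟨A, subset_rfl, hne, hall⟩
  push Not at hall
  obtain ⟨v, hv, hdeg⟩ := hall
  have hc := Finset.card_erase_add_one hv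
  have e1 : ∑ x ∈ A, (A.filter (G x)).card = (A.filter (G v)).card + ∑ x ∈ A.erase v, (A.filter (G x)).card :=
    (Finset.add_sum_erase _ _ hv).symm
  have e2 : ∀ x ∈ A.erase v, (A.filter (G x)).card = ((A.erase v).filter (G x)).card + if G v x then 1 else 0 := by
    intro x hx
    rw [Finset.filter_erase]
    split_ifs with hg
    · rw [Finset.card_erase_add_one]
      simp [hv, hs _ _ hg]
    · rw [Finset.erase_eq_of_notMem]
      · simp
      · simp only [Finset.mem_filter, not_and]
        intro _ h2
        exact hg (hs _ _ h2)
  rw [Finset.sum_congr rfl e2, Finset.sum_add_distrib] at e1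
  have e3 : (∑ x ∈ A.erase v, if G v x then 1 else 0) = (A.filter (G v)).card := by
    rw [← Finset.card_filter, Finset.filter_erase, Finset.erase_eq_of_notMem]
    simp [hi]
  rw [e3] at e1
  have hne' : (A.erase v).Nonempty := by
    rw [Finset.nonempty_iff_ne_empty]
    intro h0
    rw [h0] at e1 hc
    simp at e1 hc
    have : A.card = 1 := by omega
    rw [this] at h
    have : (A.filter (G v)).card ≤ 0 := by
      rw [Nat.le_zero, Finset.card_eq_zero, Finset.filter_eq_empty_iff]
      intro x hx
      have : x = v := by
        by_contra hxv
        have : x ∈ A.erase v := Finset.mem_erase.2 ⟨hxv, hx⟩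
        rw [h0] at this
        simp at this
      rw [this]; exact hi v
    omega
  obtain ⟨W, hW, h2⟩ := ih (A.erase v).card (by omega) (A.erase v) hne' (by
    rw [← hc] at h
    have : 4 * d * ((A.erase v).card + 1) = 4 * d * (A.erase v).card + 4 * d := by ring
    omega) rfl
  exact ⟨W, hW.trans (Finset.erase_subset _ _), h2⟩

lemma ab_path {V : Type*} [DecidableEq V] (W : Finset V) (G : V → V → Prop)
    (hi : ∀ x, ¬ G x x) (d : ℕ) (hne : W.Nonempty)
    (h : ∀ x ∈ W, d ≤ (W.filter (G x)).card) (k : ℕ) (hk : k ≤ d) :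
    ∃ a : ℕ → V, (∀ i j, i < k + 1 → j < k + 1 → a i = a j → i = j) ∧ (∀ i < k + 1, a i ∈ W) ∧
      ∀ i < k, G (a i) (a (i + 1)) := by
  induction k with
  | zero =>
    obtain ⟨w, hw⟩ := hne
    exact ⟨fun _ => w, by intros; omega, by simp [hw], by simp⟩
  | succ k ih =>
    obtain ⟨a, h1, h2, h3⟩ := ih (by omega)
    have : ∃ w ∈ W.filter (G (a k)), w ∉ (Finset.range k).image a := by
      by_contra! hcon
      have := Finset.card_le_card (show W.filter (G (a k)) ⊆ (Finset.range k).image a from hcon)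
      have h4 := Finset.card_image_le (s := Finset.range k) (f := a)
      rw [Finset.card_range] at h4
      have := h (a k) (h2 k (by omega))
      omega
    obtain ⟨w, hw, hw2⟩ := this
    rw [Finset.mem_filter] at hw
    have hw3 : ∀ i < k + 1, a i ≠ w := by
      intro i hi' he
      rcases Nat.lt_succ_iff_lt_or_eq.1 hi' with h5 | h5
      · exact hw2 (Finset.mem_image.2 ⟨i, Finset.mem_range.2 h5, he⟩)
      · subst h5
        rw [he] at hw
        exact hi w hw.2
    refine ⟨fun i => if i = k + 1 then w else a i, ?_, ?_, ?_⟩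
    · intro i j hi' hj
      dsimp only
      split_ifs with p q q
      · omega
      · intro he; exact absurd he.symm (hw3 j (by omega))
      · intro he; exact absurd he (hw3 i (by omega))
      · exact h1 i j (by omega) (by omega)
    · intro i hi'
      dsimp only
      split_ifs
      · exact hw.1
      · exact h2 i (by omega)
    · intro i hi'
      dsimp only
      rw [if_neg (by omega)]
      split_ifs with p
      · have : i = k := by omega
        subst this; exact hw.2
      · exact h3 i (by omega)

lemma ab_exp (d : ℕ) (hd : 1 ≤ d) : 2 * (d : ℝ) ^ d ≤ d.factorial * Real.exp d := by
  have h := Real.sum_le_exp_of_nonneg (x := (d : ℝ)) (by positivity) (d + 1)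
  obtain ⟨k, rfl⟩ : ∃ k, d = k + 1 := ⟨d - 1, by omega⟩
  rw [Finset.sum_range_succ, Finset.sum_range_succ] at h
  have h0 : 0 ≤ ∑ x ∈ Finset.range k, ((k + 1 : ℕ) : ℝ) ^ x / (x.factorial : ℝ) := by positivity
  have e : ((k + 1 : ℕ) : ℝ) ^ k / (k.factorial : ℝ) = ((k + 1 : ℕ) : ℝ) ^ (k+1) / ((k+1).factorial : ℝ) := by
    rw [Nat.factorial_succ]
    push_cast
    have : (k.factorial : ℝ) ≠ 0 := by positivity
    field_simp
    ring
  rw [e] at h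
  have h5 : 2 * (((k + 1 : ℕ) : ℝ) ^ (k+1) / ((k+1).factorial : ℝ)) ≤ Real.exp ((k+1 : ℕ) : ℝ) := by linarith
  have hp : (0:ℝ) < ((k+1).factorial : ℝ) := by positivity
  rw [← mul_div_assoc, div_le_iff₀ hp] at h5
  linarith

lemma ab_desc (d : ℕ) (t : ℝ) (ht : (d : ℝ) ≤ t) (hd : 1 ≤ d) :
    (d.factorial : ℝ) * (t / d) ^ d ≤ (descPochhammer ℝ d).eval t := by
  have hd' : (0 : ℝ) < d := by exact_mod_cast hd
  rw [descPochhammer_eval_eq_prod_range, ← Finset.prod_range_add_one_eq_factorial,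
    ← Finset.prod_range_reflect]
  push_cast
  rw [← Finset.card_range d, ← Finset.prod_const, Finset.card_range, ← Finset.prod_mul_distrib]
  apply Finset.prod_le_prod
  · intro i hi
    have : 0 ≤ t := hd'.le.trans ht
    positivity
  · intro i hi
    rw [Finset.mem_range] at hi
    have : ((d - 1 - i : ℕ) : ℝ) + 1 = d - i := by
      have : d - 1 - i + 1 + i = d := by omega
      have : ((d - 1 - i + 1 + i : ℕ) : ℝ) = d := by rw [this]
      push_cast at this
      linarith
    rw [this, ← mul_div_assoc, div_le_iff₀ hd']
    have : (0:ℝ) ≤ i := by positivity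
    nlinarith

lemma ab_choose {V T : Type*} [DecidableEq V] (P : Finset T) (B : Finset V) (R : T → V → Prop)
    (η : ℝ) (hη : 0 < η) (d : ℕ) (hd : 1 ≤ d) (hB : (d : ℝ) / η ≤ (B.card : ℝ)) (hP : P.Nonempty)
    (h : η * (P.card * B.card) ≤ ((∑ z ∈ P, (B.filter (R z)).card : ℕ) : ℝ)) :
    ∃ S ⊆ B, S.card = d ∧
      (P.card : ℝ) * (d.factorial * (η / d) ^ d) ≤ ((P.filter (fun z => ∀ b ∈ S, R z b)).card : ℝ) := by
  have hd' : (0 : ℝ) < d := by exact_mod_cast hd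
  have hPc : (0 : ℝ) < P.card := by exact_mod_cast hP.card_pos
  have hm : (d : ℝ) ≤ η * B.card := by
    rw [div_le_iff₀ hη] at hB; linarith
  set t : ℝ := ∑ z ∈ P, (P.card : ℝ)⁻¹ * ((B.filter (R z)).card : ℝ) with htdef
  have ht : η * B.card ≤ t := by
    rw [htdef, ← Finset.mul_sum, inv_mul_eq_div, le_div_iff₀ hPc]
    push_cast at h
    linarith
  have J := descPochhammer_eval_le_sum_descFactorial (n := d) (by omega) (t := P) (fun z => (B.filter (R z)).card)
    (fun _ => (P.card : ℝ)⁻¹) (fun _ _ => by positivity) (by simp; field_simp) (by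
      show _ ≤ t
      linarith)
  have J2 := ab_desc d t (by linarith) hd
  have J3 : (d.factorial : ℝ) * (η * B.card / d) ^ d ≤ ∑ z ∈ P, (P.card : ℝ)⁻¹ * ((B.filter (R z)).card.descFactorial d : ℝ) := by
    refine le_trans ?_ (J2.trans J)
    gcongr
  have dc : ∑ S ∈ B.powersetCard d, (P.filter (fun z => ∀ b ∈ S, R z b)).card
      = ∑ z ∈ P, ((B.filter (R z)).card.choose d) := by
    simp_rw [Finset.card_filter]
    rw [Finset.sum_comm]
    apply Finset.sum_congr rfl
    intro z hz
    rw [← Finset.card_filter, ← Finset.card_filter, ← Finset.card_powersetCard]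
    congr 1
    ext S
    simp only [Finset.mem_filter, Finset.mem_powersetCard, Finset.subset_iff]
    grind
  by_contra! hcon
  have hBd : d ≤ B.card := by
    by_contra! hlt
    have h1 : ∀ z ∈ P, (P.card : ℝ)⁻¹ * ((B.filter (R z)).card.descFactorial d : ℝ) = 0 := by
      intro z hz
      rw [Nat.descFactorial_of_lt (lt_of_le_of_lt (Finset.card_filter_le _ _) hlt)]; simp
    rw [Finset.sum_eq_zero h1] at J3
    have : (0:ℝ) < (d.factorial : ℝ) * (η * B.card / d) ^ d := by
      have : 0 < η * B.card := by linarith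
      positivity
    linarith
  have hlt : ((∑ S ∈ B.powersetCard d, (P.filter (fun z => ∀ b ∈ S, R z b)).card : ℕ) : ℝ) <
      ∑ S ∈ B.powersetCard d, (P.card : ℝ) * (d.factorial * (η / d) ^ d) := by
    push_cast
    apply Finset.sum_lt_sum_of_nonempty (Finset.powersetCard_nonempty.2 hBd)
    intro S hS
    rw [Finset.mem_powersetCard] at hS
    exact hcon S hS.1 hS.2
  rw [dc, Finset.sum_const, Finset.card_powersetCard, nsmul_eq_mul] at hlt
  have hf : (0:ℝ) < d.factorial := by positivity
  have key : (∑ z ∈ P, (P.card : ℝ)⁻¹ * ((B.filter (R z)).card.descFactorial d : ℝ))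
      = (P.card : ℝ)⁻¹ * (d.factorial * ((∑ z ∈ P, ((B.filter (R z)).card.choose d) : ℕ) : ℝ)) := by
    rw [← Finset.mul_sum]
    simp_rw [Nat.descFactorial_eq_factorial_mul_choose]
    push_cast
    rw [← Finset.mul_sum]
  rw [key, inv_mul_eq_div, le_div_iff₀ hPc] at J3
  have hcm : (d.factorial : ℝ) * (B.card.choose d : ℝ) ≤ (B.card : ℝ) ^ d := by
    rw [← Nat.cast_mul, ← Nat.descFactorial_eq_factorial_mul_choose]
    exact_mod_cast Nat.descFactorial_le_pow _ _
  have h7 : (d.factorial : ℝ) * (((∑ z ∈ P, ((B.filter (R z)).card.choose d) : ℕ) : ℝ)) <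
      d.factorial * ((B.card.choose d : ℝ) * ((P.card : ℝ) * (d.factorial * (η / d) ^ d))) := by
    gcongr
  have h8 : d.factorial * ((B.card.choose d : ℝ) * ((P.card : ℝ) * (d.factorial * (η / d) ^ d)))
      ≤ (B.card : ℝ) ^ d * ((P.card : ℝ) * (d.factorial * (η / d) ^ d)) := by
    rw [← mul_assoc]
    gcongr
  have h9 : (d.factorial : ℝ) * (η * B.card / d) ^ d * P.card = (B.card : ℝ) ^ d * ((P.card : ℝ) * (d.factorial * (η / d) ^ d)) := by
    rw [div_pow, mul_pow, div_pow]; ring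
  linarith

/-- Absorbing block lemma: if `A` induces a clique, `|A| ≥ 4d·e^d/η^d`,
`|B| ≥ d/η`, `A ∩ B = ∅` and `d(A,A,B) ≥ η`, then `F` contains the tight path
`a₁a₂b₁a₃a₄b₂ … a_{2d-1}a_{2d}b_d a_{2d+1}a_{2d+2}` with all `aᵢ ∈ A` distinct
and all `bⱼ ∈ B` distinct.  Here `u` is the corresponding vertex sequence of
length `3d+2`, and being a tight path means that every three consecutive vertices
of `u` form an edge. -/
theorem absorbing_block {N : ℕ} (η : ℝ) (hη₀ : 0 < η) (hη₁ : η ≤ 1)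
    (d : ℕ) (hd : 1 ≤ d) (E : Finset (Finset (Fin N))) (A B : Finset (Fin N))
    (hAB : Disjoint A B)
    (hA : 4 * (d : ℝ) * Real.exp d / η ^ d ≤ (A.card : ℝ))
    (hB : (d : ℝ) / η ≤ (B.card : ℝ))
    (hclique : ∀ e : Finset (Fin N), e.card = 3 → e ⊆ A → e ∈ E)
    (hdens : η ≤ tripleDensity E A A B) :
    ∃ (a b u : ℕ → Fin N),
      (∀ i j, i < 2 * d + 2 → j < 2 * d + 2 → a i = a j → i = j) ∧
      (∀ i j, i < d → j < d → b i = b j → i = j) ∧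
      (∀ i < 2 * d + 2, a i ∈ A) ∧
      (∀ j < d, b j ∈ B) ∧
      (∀ p, u p = if p % 3 = 2 then b (p / 3) else a (2 * (p / 3) + p % 3)) ∧
      (∀ p, p + 2 < 3 * d + 2 →
        ({u p, u (p + 1), u (p + 2)} : Finset (Fin N)) ∈ E) := by
  have hd' : (1 : ℝ) ≤ d := by exact_mod_cast hd
  have hBpos : 0 < B.card := by
    have : (0:ℝ) < B.card := lt_of_lt_of_le (by positivity) hB
    exact_mod_cast this
  have hηd : η ^ d ≤ 1 := pow_le_one₀ hη₀.le hη₁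
  have hηp : 0 < η ^ d := by positivity
  have hexp : (1:ℝ) ≤ Real.exp d := Real.one_le_exp (by positivity)
  rw [div_le_iff₀ hηp] at hA
  have hA4 : (4 : ℝ) ≤ A.card := by
    have h1 : (A.card : ℝ) * η ^ d ≤ A.card := mul_le_of_le_one_right (by positivity) hηd
    nlinarith
  have hA4' : 4 ≤ A.card := by exact_mod_cast hA4
  let P : Finset (Fin N × Fin N) := A.offDiag
  have hPc : (P.card : ℝ) = A.card * (A.card - 1) := by
    have : P.card = A.card * A.card - A.card := Finset.offDiag_card A
    rw [this, Nat.cast_sub (Nat.le_mul_self _)]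
    push_cast; ring
  have hPpos : (0:ℝ) < P.card := by rw [hPc]; nlinarith
  have hPne : P.Nonempty := by
    rw [← Finset.card_pos]; exact_mod_cast hPpos
  obtain ⟨R, hR⟩ : ∃ R : Fin N × Fin N → Fin N → Prop,
      ∀ z b, R z b ↔ ({z.1, z.2, b} : Finset (Fin N)) ∈ E := ⟨_, fun _ _ => Iff.rfl⟩
  have hden : ((A ×ˢ A ×ˢ B).filter (fun z =>
      z.1 ≠ z.2.1 ∧ z.1 ≠ z.2.2 ∧ z.2.1 ≠ z.2.2)).card = P.card * B.card := by
    rw [← Finset.card_product]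
    refine Finset.card_bij' (fun z _ => ((z.1, z.2.1), z.2.2)) (fun z _ => (z.1.1, z.1.2, z.2))
      ?_ ?_ ?_ ?_
    · intro z; simp [P]; tauto
    · intro z
      simp only [P, Finset.mem_product, Finset.mem_filter, Finset.mem_offDiag]
      rintro ⟨⟨h1, h2, h3⟩, h4⟩
      exact ⟨⟨h1, h2, h4⟩, h3, fun h => Finset.disjoint_left.1 hAB h1 (h ▸ h4), fun h => Finset.disjoint_left.1 hAB h2 (h ▸ h4)⟩
    · intros; rfl
    · intros; rfl
  have hnum : ((A ×ˢ A ×ˢ B).filter (fun z =>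
      z.1 ≠ z.2.1 ∧ z.1 ≠ z.2.2 ∧ z.2.1 ≠ z.2.2 ∧
        ({z.1, z.2.1, z.2.2} : Finset (Fin N)) ∈ E)).card ≤ ∑ z ∈ P, (B.filter (R z)).card := by
    rw [← Finset.card_sigma]
    apply Finset.card_le_card_of_injOn (fun z => ⟨(z.1, z.2.1), z.2.2⟩)
    · intro z
      simp only [P, hR, Finset.coe_filter, Finset.mem_product, Set.mem_ofPred_eq, Finset.coe_sigma, Set.mem_sigma_iff, Finset.mem_coe, Finset.mem_offDiag]
      tauto
    · rintro ⟨x, y, z⟩ _ ⟨x', y', z'⟩ _ h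
      simp at h
      obtain ⟨⟨rfl, rfl⟩, rfl⟩ := h
      rfl
  have hB' : (0:ℝ) < B.card := by exact_mod_cast hBpos
  have hsum : η * (P.card * B.card) ≤ ((∑ z ∈ P, (B.filter (R z)).card : ℕ) : ℝ) := by
    unfold tripleDensity at hdens
    rw [hden, le_div_iff₀ (by push_cast; positivity)] at hdens
    push_cast at hdens
    refine hdens.trans ?_
    exact_mod_cast hnum
  obtain ⟨S, hSB, hSc, hS⟩ := ab_choose P B R η hη₀ d hd hB hPne hsum
  obtain ⟨G, hG⟩ : ∃ G : Fin N → Fin N → Prop,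
      ∀ x y, G x y ↔ (x ≠ y ∧ ∀ b ∈ S, R (x, y) b) := ⟨_, fun _ _ => Iff.rfl⟩
  have hGs : ∀ x y, G x y → G y x := by
    intro x y h
    rw [hG] at h ⊢
    obtain ⟨h1, h2⟩ := h
    refine ⟨h1.symm, fun b hb => ?_⟩
    have := h2 b hb
    simp only [hR] at this ⊢
    rwa [Finset.insert_comm]
  have hGi : ∀ x, ¬ G x x := fun x h => ((hG x x).1 h).1 rfl
  have hcnt : (P.filter (fun z => ∀ b ∈ S, R z b)).card ≤ ∑ x ∈ A, (A.filter (G x)).card := by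
    rw [← Finset.card_sigma]
    apply Finset.card_le_card_of_injOn (fun z => ⟨z.1, z.2⟩)
    · intro z
      simp only [P, hG, Finset.coe_filter, Set.mem_ofPred_eq, Finset.coe_sigma, Set.mem_sigma_iff, Finset.mem_coe, Finset.mem_offDiag]
      tauto
    · rintro ⟨x, y⟩ _ ⟨x', y'⟩ _ h
      simp at h
      obtain ⟨rfl, rfl⟩ := h
      rfl
  have hbig : 4 * d * A.card ≤ ∑ x ∈ A, (A.filter (G x)).card := by
    refine le_trans ?_ hcnt
    have : (4 * d * A.card : ℝ) ≤ (P.card : ℝ) * (d.factorial * (η / d) ^ d) := by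
      have he := ab_exp d hd
      rw [hPc, div_pow]
      have hdd : (0:ℝ) < (d:ℝ) ^ d := by positivity
      have h1 : (d.factorial : ℝ) * (4 * d * Real.exp d) ≤ d.factorial * (A.card * η ^ d) := by gcongr
      have h2 : 8 * (d : ℝ) * d ^ d ≤ d.factorial * (A.card * η ^ d) := by nlinarith
      have h3 : 8 * (d:ℝ) ≤ A.card * (d.factorial * (η ^ d / d ^ d)) := by
        have : A.card * (d.factorial * (η ^ d / d ^ d)) = (d.factorial * (A.card * η ^ d)) / (d:ℝ) ^ d := by ring
        rw [this, le_div_iff₀ hdd]; exact h2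
      have h4 : 8 * (d:ℝ) * (A.card - 1) ≤ A.card * (d.factorial * (η ^ d / d ^ d)) * (A.card - 1) :=
        mul_le_mul_of_nonneg_right h3 (by linarith)
      nlinarith
    have h5 := this.trans hS
    norm_cast at h5
    refine h5.trans (le_of_eq ?_)
    congr
  obtain ⟨W, hWA, hWne, hW⟩ := ab_mindeg A G hGs hGi d hd (Finset.card_pos.1 (by omega)) hbig
  obtain ⟨a, ha1, ha2, ha3⟩ := ab_path W G hGi (2 * d + 1) hWne hW (2 * d + 1) le_rfl
  let f := S.equivFinOfCardEq hSc
  let b : ℕ → Fin N := fun j => if h : j < d then (f.symm ⟨j, h⟩ : Fin N) else a 0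
  have hbS : ∀ j < d, b j ∈ S := by
    intro j hj
    simp only [b, dif_pos hj]
    exact (f.symm ⟨j, hj⟩).2
  refine ⟨a, b, fun p => if p % 3 = 2 then b (p / 3) else a (2 * (p / 3) + p % 3), ha1, ?_,
    fun i hi => hWA (ha2 i hi), fun j hj => hSB (hbS j hj), fun _ => rfl, ?_⟩
  · intro i j hi hj h
    simp only [b, dif_pos hi, dif_pos hj] at h
    have := f.symm.injective (Subtype.ext h)
    simpa using this
  · intro p hp
    have hE : ∀ i j, i < 2 * d + 1 → j < d → ({a i, a (i+1), b j} : Finset (Fin N)) ∈ E :=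
      fun i j hi hj => (hR _ _).1 (((hG _ _).1 (ha3 i hi)).2 _ (hbS j hj))
    obtain ⟨q, r, hr, rfl⟩ : ∃ q r, r < 3 ∧ p = 3 * q + r := ⟨p / 3, p % 3, Nat.mod_lt _ (by norm_num), by omega⟩
    have hq : q < d := by omega
    dsimp only
    interval_cases r
    · rw [if_neg (by omega), if_neg (by omega), if_pos (by omega),
        show 2 * ((3 * q + 0) / 3) + (3 * q + 0) % 3 = 2 * q by omega,
        show 2 * ((3 * q + 0 + 1) / 3) + (3 * q + 0 + 1) % 3 = 2 * q + 1 by omega,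
        show (3 * q + 0 + 2) / 3 = q by omega]
      exact hE (2 * q) q (by omega) hq
    · rw [if_neg (by omega), if_pos (by omega), if_neg (by omega), Finset.pair_comm,
        show 2 * ((3 * q + 1) / 3) + (3 * q + 1) % 3 = 2 * q + 1 by omega,
        show 2 * ((3 * q + 1 + 2) / 3) + (3 * q + 1 + 2) % 3 = 2 * q + 1 + 1 by omega,
        show (3 * q + 1 + 1) / 3 = q by omega]
      exact hE (2 * q + 1) q (by omega) hq
    · rw [if_pos (by omega), if_neg (by omega), if_neg (by omega), Finset.insert_comm,
        Finset.pair_comm,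
        show 2 * ((3 * q + 2 + 1) / 3) + (3 * q + 2 + 1) % 3 = 2 * q + 2 by omega,
        show 2 * ((3 * q + 2 + 2) / 3) + (3 * q + 2 + 2) % 3 = 2 * q + 2 + 1 by omega,
        show (3 * q + 2) / 3 = q by omega]
      exact hE (2 * q + 2) q (by omega) hq
end
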